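/- Truthfulness of the maximal-equilibrium mechanism under full enforcement: fix an agent i with true type (b_i, c_i), and suppose all agents' benefit functions are continuous, nondecreasing, concave on [0, ∞) with the vanishing-marginal-value condition and all costs are positive. Let (b̂_i, ĉ_i) be any misreport satisfying the same regularity conditions, and consider the misreported game in which agent i's utility uses (b̂_i, ĉ_i) while all other agents keep their true types. Let X be a pure Nash equilibrium of the true game whose total-data vector componentwise dominates that of every pure Nash equilibrium of the true game, and let X' be a pure Nash equilibrium of the misreported game whose total-data vector componentwise dominates that of every pure Nash equilibrium of the misreported game. Then agent i's true utility satisfies b_i(t_i(X')) − c_i · X' i ≤ b_i(t_i(X)) − c_i · X i. -/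

import Mathlib

open Finset

/-- Agent `i`'s total accessible data under fair exchange. -/
noncomputable def total {n : ℕ} (X : Fin n → ℝ) (i : Fin n) : ℝ :=
  X i + ∑ j ∈ univ.filter (fun j => j ≠ i), min (X i) (X j)

/-- Agent `i`'s utility in the game with benefit functions `b` and costs `c`. -/
noncomputable def U {n : ℕ} (b : Fin n → ℝ → ℝ) (c : Fin n → ℝ)
    (X : Fin n → ℝ) (i : Fin n) : ℝ :=
  b i (total X i) - c i * X i

/-- `X` is a (nonnegative) pure Nash equilibrium of the game with benefits `b`, costs `c`. -/
def IsNE {n : ℕ} (b : Fin n → ℝ → ℝ) (c : Fin n → ℝ) (X : Fin n → ℝ) : Prop :=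
  (∀ i, 0 ≤ X i) ∧
    ∀ i, ∀ y, 0 ≤ y → U b c (Function.update X i y) i ≤ U b c X i


lemma int_congr {f g : ℝ → ℝ} {x y : ℝ} (h : Set.EqOn f g (Set.uIoc x y)) :
    ∫ s in x..y, f s = ∫ s in x..y, g s :=
  intervalIntegral.integral_congr_ae (Filter.Eventually.of_forall fun _ hs => h hs)

def PP (b : ℝ → ℝ) (d t : ℝ) : Prop := ∀ s, 0 ≤ s → s ≤ t → b s - d * s ≤ b t - d * t

lemma qc {b : ℝ → ℝ} (hb : ConcaveOn ℝ (Set.Ici 0) b) (d : ℝ) {x y z : ℝ} (hx : 0 ≤ x)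
    (hxy : x ≤ y) (hyz : y ≤ z) :
    min (b x - d * x) (b z - d * z) ≤ b y - d * y := by
  rcases eq_or_lt_of_le hxy with h | h
  · subst h; exact min_le_left _ _
  rcases eq_or_lt_of_le hyz with h' | h'
  · subst h'; exact min_le_right _ _
  have hf : ConcaveOn ℝ (Set.Ici (0:ℝ)) (fun s => b s - d * s) := by
    refine hb.sub ?_
    exact (LinearMap.convexOn (d • (LinearMap.id : ℝ →ₗ[ℝ] ℝ)) (convex_Ici 0))
  have := hf.min_le_of_mem_Icc (x := x) (y := z) (z := y) hx (by simp; linarith) ⟨hxy, hyz⟩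
  exact this

lemma qc_strict {b : ℝ → ℝ} (hb : ConcaveOn ℝ (Set.Ici 0) b) (d : ℝ) {s u t : ℝ} (hs : 0 ≤ s)
    (hsu : s ≤ u) (hut : u < t) (h : b u - d * u ≤ b t - d * t) :
    b s - d * s ≤ b t - d * t := by
  rcases eq_or_lt_of_le hsu with h0 | h0
  · subst h0; exact h
  have := hb.slope_anti_adjacent (x := s) (y := u) (z := t) hs (by simp; linarith) h0 hut
  rw [div_le_div_iff₀ (by linarith) (by linarith)] at this
  by_contra hcon
  push Not at hcon
  have h1 : 0 < u - s := by linarith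
  have h2 : 0 < t - u := by linarith
  have h3 : d * (t - u) ≤ b t - b u := by linarith
  have h4 : b u - b s < d * (u - s) := by linarith
  nlinarith [mul_le_mul_of_nonneg_right h3 h1.le, mul_lt_mul_of_pos_right h4 h2]

lemma PP_mono {b : ℝ → ℝ} (hb : ConcaveOn ℝ (Set.Ici 0) b) {d d' t r : ℝ}
    (hd : d' ≤ d) (hr : r ≤ t) (h : PP b d t) : PP b d' r := by
  intro s hs hsr
  have h1 := h s hs (hsr.trans hr)
  have h2 := qc hb d hs hsr hr
  rw [min_eq_left h1] at h2
  nlinarith [mul_nonneg (sub_nonneg.2 hd) (sub_nonneg.2 hsr)]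

lemma tau_exists {b : ℝ → ℝ} (hb : ConcaveOn ℝ (Set.Ici 0) b) (hcont : ContinuousOn b (Set.Ici 0))
    (hv : Filter.Tendsto (fun t : ℝ => b (t + 1) - b t) Filter.atTop (nhds 0))
    (d : ℝ) (hd : 0 < d) :
    ∃ τ : ℝ, 0 ≤ τ ∧ (∀ t, 0 ≤ t → PP b d t → t ≤ τ) ∧ PP b d τ ∧
      ∀ s s', τ ≤ s → s ≤ s' → b s' - d * s' ≤ b s - d * s := by
  obtain ⟨T, hT0, hT⟩ : ∃ T : ℝ, 0 ≤ T ∧ b (T + 1) - b T < d := by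
    have h1 := (hv.eventually (gt_mem_nhds hd)).and (Filter.eventually_ge_atTop 0)
    obtain ⟨T, h⟩ := h1.exists
    exact ⟨T, h.2, h.1⟩
  have hfc : ContinuousOn (fun s => b s - d * s) (Set.Icc 0 (T+1)) :=
    (hcont.mono Set.Icc_subset_Ici_self).sub (by fun_prop)
  obtain ⟨u, hu, humax⟩ := isCompact_Icc.exists_isMaxOn (s := Set.Icc 0 (T+1))
    ⟨0, by constructor <;> linarith⟩ hfc
  have hbig : ∀ s, T + 1 < s → b s - d * s < b T - d * T := by
    intro s hs
    by_contra hcon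
    push Not at hcon
    have := qc hb d hT0 (y := T+1) (z := s) (by linarith) hs.le
    rw [min_eq_left hcon] at this
    linarith
  have hglob : ∀ s, 0 ≤ s → b s - d * s ≤ b u - d * u := by
    intro s hs
    by_cases h : s ≤ T + 1
    · exact humax ⟨hs, h⟩
    · push Not at h
      exact (hbig s h).le.trans (humax (a := T) ⟨hT0, by linarith⟩)
  have hK : IsCompact (Set.Icc 0 (T+1) ∩ (fun s => b s - d * s) ⁻¹' {b u - d * u}) :=
    isCompact_Icc.of_isClosed_subset
      (hfc.preimage_isClosed_of_isClosed isClosed_Icc isClosed_singleton) Set.inter_subset_left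
  obtain ⟨τ, ⟨hτ1, hτ2⟩, hτ3⟩ := hK.exists_isGreatest ⟨u, hu, rfl⟩
  simp only [Set.mem_preimage, Set.mem_singleton_iff] at hτ2
  have hτg : ∀ s, 0 ≤ s → b s - d * s ≤ b τ - d * τ := by
    intro s hs; rw [hτ2]; exact hglob s hs
  refine ⟨τ, hτ1.1, ?_, fun s hs _ => hτg s hs, ?_⟩
  · intro t ht hP
    by_contra hcon
    push Not at hcon
    have h1 := hP τ hτ1.1 hcon.le
    have h2 : b t - d * t = b u - d * u := by
      have := hglob t ht
      linarith
    have h3 : t ≤ T + 1 := by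
      by_contra h
      push Not at h
      have := hbig t h
      have := hglob T hT0
      linarith
    have := hτ3 ⟨⟨ht, h3⟩, h2⟩
    linarith
  · intro s s' h1 h2
    have h3 := hτg s' (by linarith [hτ1.1])
    have := qc hb d hτ1.1 h1 h2
    rwa [min_eq_right h3] at this

/-- number of agents with total at least `s` -/
noncomputable def NN {n : ℕ} (t : Fin n → ℝ) (s : ℝ) : ℕ := #{k | s ≤ t k}

noncomputable def GG {n : ℕ} (t : Fin n → ℝ) (T : ℝ) : ℝ := ∫ s in (0:ℝ)..T, ((NN t s : ℝ))⁻¹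

lemma NN_int {n : ℕ} (t : Fin n → ℝ) (x y : ℝ) :
    IntervalIntegrable (fun s => ((NN t s : ℝ))⁻¹) MeasureTheory.volume x y := by
  have hanti : Antitone (fun s => (NN t s : ℝ)) := by
    intro s s' h
    simp only [NN, Nat.cast_le]
    apply card_le_card
    intro k
    simp only [mem_filter, mem_univ, true_and]
    intro h'; linarith
  have hm : Measurable (fun s => ((NN t s : ℝ))⁻¹) := hanti.measurable.inv
  refine (intervalIntegrable_const (c := (1:ℝ))).mono_fun hm.aestronglyMeasurable ?_
  refine Filter.Eventually.of_forall fun s => ?_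
  simp only [norm_one]
  rw [Real.norm_of_nonneg (by positivity)]
  exact Nat.cast_inv_le_one _

lemma GG_mono {n : ℕ} (t : Fin n → ℝ) : Monotone (GG t) := by
  intro x y h
  have := intervalIntegral.integral_add_adjacent_intervals (NN_int t 0 x) (NN_int t x y)
  have h2 : 0 ≤ ∫ s in x..y, ((NN t s : ℝ))⁻¹ :=
    intervalIntegral.integral_nonneg h (fun s _ => by positivity)
  unfold GG
  linarith

lemma GG_nonneg {n : ℕ} (t : Fin n → ℝ) {T : ℝ} (h : 0 ≤ T) : 0 ≤ GG t T := by
  have := GG_mono t h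
  simpa [GG] using this

lemma GG_min {n : ℕ} (t : Fin n → ℝ) (ht : ∀ k, 0 ≤ t k) {T : ℝ} (hT : 0 ≤ T) (k : Fin n) :
    IntervalIntegrable (fun s => if s ≤ t k then ((NN t s : ℝ))⁻¹ else 0)
        MeasureTheory.volume 0 T ∧
      min (GG t T) (GG t (t k)) =
      ∫ s in (0:ℝ)..T, (if s ≤ t k then ((NN t s : ℝ))⁻¹ else 0) := by
  rw [← (GG_mono t).map_min]
  have h0 : 0 ≤ min T (t k) := le_min hT (ht k)
  have e1 : Set.EqOn (fun s => ((NN t s : ℝ))⁻¹)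
      (fun s => if s ≤ t k then ((NN t s : ℝ))⁻¹ else 0) (Set.uIoc 0 (min T (t k))) := by
    intro s hs
    rw [Set.uIoc_of_le h0] at hs
    have : s ≤ t k := hs.2.trans (min_le_right _ _)
    simp [this]
  have e2 : Set.EqOn (fun s => (0:ℝ))
      (fun s => if s ≤ t k then ((NN t s : ℝ))⁻¹ else 0) (Set.uIoc (min T (t k)) T) := by
    intro s hs
    rw [Set.uIoc_of_le (min_le_left _ _)] at hs
    have : ¬ s ≤ t k := by
      intro h
      have := le_min hs.2 h
      linarith [hs.1]
    simp [this]
  have i1 := (NN_int t 0 (min T (t k))).congr e1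
  have i2 : IntervalIntegrable (fun s => if s ≤ t k then ((NN t s : ℝ))⁻¹ else 0)
      MeasureTheory.volume (min T (t k)) T := (intervalIntegrable_const (c := (0:ℝ))).congr e2
  refine ⟨i1.trans i2, ?_⟩
  rw [← intervalIntegral.integral_add_adjacent_intervals i1 i2]
  have j2 : (∫ s in (min T (t k))..T, (if s ≤ t k then ((NN t s : ℝ))⁻¹ else 0)) = 0 := by
    rw [← int_congr e2]; simp
  rw [j2, add_zero, GG]
  exact int_congr e1

lemma GG_sum {n : ℕ} (t : Fin n → ℝ) (ht : ∀ k, 0 ≤ t k) {T : ℝ} (hT : 0 ≤ T) (k0 : Fin n)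
    (hk0 : T ≤ t k0) : ∑ k, min (GG t T) (GG t (t k)) = T := by
  rw [Finset.sum_congr rfl (fun k _ => (GG_min t ht hT k).2),
    ← intervalIntegral.integral_finsetSum (fun k _ => (GG_min t ht hT k).1)]
  have e : Set.EqOn (fun s => ∑ k, (if s ≤ t k then ((NN t s : ℝ))⁻¹ else 0)) (fun s => (1:ℝ))
      (Set.uIoc 0 T) := by
    intro s hs
    rw [Set.uIoc_of_le hT] at hs
    have : 0 < NN t s := card_pos.2 ⟨k0, by simp; linarith [hs.2]⟩
    simp only [← Finset.sum_filter, Finset.sum_const, nsmul_eq_mul]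
    exact mul_inv_cancel₀ (by positivity)
  rw [int_congr e]
  simp

lemma total_eq {n : ℕ} (X : Fin n → ℝ) (i : Fin n) : total X i = ∑ k, min (X i) (X k) := by
  rw [total, Finset.filter_ne', ← Finset.add_sum_erase _ _ (mem_univ i), min_self]

lemma total_upd {n : ℕ} (X : Fin n → ℝ) (i : Fin n) (y : ℝ) :
    total (Function.update X i y) i = y + ∑ k ∈ univ.erase i, min y (X k) := by
  rw [total, Finset.filter_ne', Function.update_self]
  congr 1
  refine Finset.sum_congr rfl fun k hk => ?_
  rw [Function.update_of_ne (ne_of_mem_erase hk)]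

lemma total_upd_le {n : ℕ} (X : Fin n → ℝ) (i : Fin n) (y : ℝ) (hy : y ≤ X i) :
    total (Function.update X i y) i = ∑ k, min y (X k) := by
  rw [total_upd, ← Finset.add_sum_erase _ _ (mem_univ i), min_eq_left hy]

lemma total_nonneg {n : ℕ} {X : Fin n → ℝ} (hX : ∀ k, 0 ≤ X k) (i : Fin n) : 0 ≤ total X i := by
  rw [total_eq]; exact Finset.sum_nonneg fun k _ => le_min (hX i) (hX k)

lemma total_le_iff {n : ℕ} (X : Fin n → ℝ) (j k : Fin n) :
    total X j ≤ total X k ↔ X j ≤ X k := by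
  constructor
  · intro h
    by_contra hc
    push Not at hc
    have : total X k < total X j := by
      rw [total_eq, total_eq]
      refine Finset.sum_lt_sum (fun l _ => min_le_min_right _ hc.le) ⟨j, mem_univ _, ?_⟩
      rw [min_eq_left hc.le, min_self]; exact hc
    linarith
  · intro h
    rw [total_eq, total_eq]
    exact Finset.sum_le_sum (fun l _ => min_le_min_right _ h)

lemma total_inj_aux {n : ℕ} (X Y : Fin n → ℝ) (h : ∀ j, total X j = total Y j) (a : Fin n)
    (hlt : ∀ k, total X k < total X a → X k = Y k) : ¬ X a < Y a := by
  intro hXY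
  have : total X a < total Y a := by
    rw [total_eq, total_eq]
    refine Finset.sum_lt_sum (fun k _ => ?_) ⟨a, mem_univ _, by simpa using hXY⟩
    by_cases hk : total X k < total X a
    · rw [hlt k hk]; exact min_le_min_right _ hXY.le
    · push Not at hk
      have h1 := (total_le_iff X a k).1 hk
      rw [h, h] at hk
      have h2 := (total_le_iff Y a k).1 hk
      rw [min_eq_left h1, min_eq_left h2]; exact hXY.le
  rw [h] at this
  exact lt_irrefl _ this

lemma total_inj {n : ℕ} (X Y : Fin n → ℝ) (h : ∀ j, total X j = total Y j) : X = Y := by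
  by_contra hne
  have : (univ.filter fun j => X j ≠ Y j).Nonempty := by
    obtain ⟨j, hj⟩ := Function.ne_iff.1 hne
    exact ⟨j, by simpa using hj⟩
  obtain ⟨a, ha, hmin⟩ := Finset.exists_min_image _ (total X) this
  simp only [mem_filter, mem_univ, true_and] at ha hmin
  have hlt : ∀ k, total X k < total X a → X k = Y k := by
    intro k hk
    by_contra hc
    linarith [hmin k hc]
  rcases lt_or_gt_of_ne ha with h1 | h1
  · exact total_inj_aux X Y h a hlt h1
  · refine total_inj_aux Y X (fun j => (h j).symm) a (fun k hk => ?_) h1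
    rw [← h, ← h] at hk
    exact (hlt k hk).symm

lemma total_GG {n : ℕ} (t : Fin n → ℝ) (ht : ∀ k, 0 ≤ t k) (j : Fin n) :
    total (fun k => GG t (t k)) j = t j := by
  rw [total_eq]; exact GG_sum t ht (ht j) j le_rfl

lemma rep {n : ℕ} {X : Fin n → ℝ} (hX : ∀ k, 0 ≤ X k) (j : Fin n) :
    X j = GG (total X) (total X j) := by
  have := total_inj X (fun k => GG (total X) (total X k))
    (fun j => (total_GG _ (total_nonneg hX) j).symm)
  exact congrFun this j

lemma NN_pos {n : ℕ} (t : Fin n → ℝ) (j : Fin n) : 0 < NN t (t j) :=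
  card_pos.2 ⟨j, by simp⟩

lemma nec {n : ℕ} {b : Fin n → ℝ → ℝ} {c : Fin n → ℝ} {X : Fin n → ℝ} (hX : IsNE b c X)
    (j : Fin n) (hb : ConcaveOn ℝ (Set.Ici 0) (b j)) :
    PP (b j) (c j / NN (total X) (total X j)) (total X j) := by
  intro s hs hst
  rcases eq_or_lt_of_le hst with h | h
  · rw [h]
  set t := total X j with ht
  set m := NN (total X) t with hm
  have hmpos : (0:ℝ) < m := by exact_mod_cast NN_pos (total X) j
  have hXj : 0 < X j := by
    rcases eq_or_lt_of_le (hX.1 j) with h0 | h0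
    · have : t = 0 := by
        rw [ht, total_eq, ← h0]
        exact Finset.sum_eq_zero fun k _ => min_eq_left (hX.1 k)
      linarith
    · exact h0
  obtain ⟨δ, hδ, hδ1, hδ2, hδ3⟩ : ∃ δ : ℝ, 0 < δ ∧ δ < X j ∧ δ < (t - s) / m ∧
      ∀ k, X k < X j → δ < X j - X k := by
    have h1 : ∀ x : ℝ, 0 < x → ∀ᶠ δ in nhdsWithin (0:ℝ) (Set.Ioi 0), δ < x := fun x hx =>
      (Filter.Eventually.filter_mono nhdsWithin_le_nhds (gt_mem_nhds hx))
    have h2 : ∀ᶠ δ in nhdsWithin (0:ℝ) (Set.Ioi 0), ∀ k, X k < X j → δ < X j - X k := by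
      rw [Filter.eventually_all]
      intro k
      by_cases hk : X k < X j
      · filter_upwards [h1 (X j - X k) (by linarith)] with δ h _ using h
      · exact Filter.Eventually.of_forall fun δ h => absurd h hk
    obtain ⟨δ, hh⟩ := ((h1 _ hXj).and ((h1 ((t-s)/m) (div_pos (by linarith) hmpos)).and
      (h2.and self_mem_nhdsWithin))).exists
    exact ⟨δ, hh.2.2.2, hh.1, hh.2.1, hh.2.2.1⟩
  have hdev := hX.2 j (X j - δ) (by linarith)
  have htot : total (Function.update X j (X j - δ)) j = t - m * δ := by
    rw [total_upd_le _ _ _ (by linarith), ht, total_eq, eq_sub_iff_add_eq]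
    have : (m : ℝ) * δ = ∑ k, if t ≤ total X k then δ else 0 := by
      rw [← Finset.sum_filter, Finset.sum_const, nsmul_eq_mul, hm, NN]
    rw [this, ← Finset.sum_add_distrib]
    refine Finset.sum_congr rfl fun k _ => ?_
    simp only [ht, total_le_iff]
    by_cases hk : X j ≤ X k
    · rw [if_pos hk, min_eq_left hk, min_eq_left (by linarith)]; ring
    · rw [if_neg hk]
      push Not at hk
      have := hδ3 k hk
      rw [min_eq_right hk.le, min_eq_right (by linarith), add_zero]
  unfold U at hdev
  rw [htot, Function.update_self, ← ht] at hdev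
  rw [lt_div_iff₀ hmpos] at hδ2
  refine qc_strict hb _ hs (u := t - m * δ) (by linarith) (by nlinarith) ?_
  have : c j / m * (t - m * δ) = c j / m * t - c j * δ := by field_simp
  rw [this]
  linarith

lemma exists_max {n : ℕ} {b : Fin n → ℝ → ℝ} {c : Fin n → ℝ}
    (hc : ∀ j, 0 < c j)
    (hbc : ∀ j, ContinuousOn (b j) (Set.Ici 0))
    (hbm : ∀ j, MonotoneOn (b j) (Set.Ici 0))
    (hbconc : ∀ j, ConcaveOn ℝ (Set.Ici 0) (b j))
    (hvanish : ∀ j, Filter.Tendsto (fun t : ℝ => b j (t + 1) - b j t)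
      Filter.atTop (nhds 0)) :
    ∃ Z, IsNE b c Z ∧ ∀ (S : Finset (Fin n)) (j) (r : ℝ), j ∈ S → 0 ≤ r →
      (∀ k ∈ S, PP (b k) (c k / #S) r) → r ≤ total Z j := by
  have H : ∀ j (m : ℕ), ∃ τ : ℝ, 0 < m → (0 ≤ τ ∧ (∀ t, 0 ≤ t → PP (b j) (c j / m) t → t ≤ τ) ∧
      PP (b j) (c j / m) τ ∧
      ∀ s s', τ ≤ s → s ≤ s' → b j s' - c j / m * s' ≤ b j s - c j / m * s) := by
    intro j m
    by_cases hm : 0 < m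
    · obtain ⟨τ, h⟩ := tau_exists (hbconc j) (hbc j) (hvanish j) (c j / m)
        (div_pos (hc j) (by exact_mod_cast hm))
      exact ⟨τ, fun _ => h⟩
    · exact ⟨0, fun h => absurd h hm⟩
  choose τ hτ using H
  have hτmono : ∀ j (m m' : ℕ), 0 < m → m ≤ m' → τ j m ≤ τ j m' := by
    intro j m m' hm hmm
    refine (hτ j m' (by omega)).2.1 _ (hτ j m hm).1 (PP_mono (hbconc j) ?_ le_rfl (hτ j m hm).2.2.1)
    have : (m:ℝ) ≤ m' := by exact_mod_cast hmm
    have h0 : (0:ℝ) < m := by exact_mod_cast hm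
    exact div_le_div_of_nonneg_left (hc j).le h0 this
  -- the maximal totals
  have HT : ∀ j, ∃ r : ℝ, (∃ S : Finset (Fin n), j ∈ S ∧ ∀ k ∈ S, r ≤ τ k #S) ∧
      ∀ S : Finset (Fin n), j ∈ S → ∀ r', (∀ k ∈ S, r' ≤ τ k #S) → r' ≤ r := by
    intro j
    have hg : ∀ S : Finset (Fin n), ∃ g : ℝ, j ∈ S → (∀ k ∈ S, g ≤ τ k #S) ∧
        ∀ r', (∀ k ∈ S, r' ≤ τ k #S) → r' ≤ g := by
      intro S
      by_cases hS : j ∈ S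
      · obtain ⟨a, ha, hmin⟩ := Finset.exists_min_image S (fun k => τ k #S) ⟨j, hS⟩
        exact ⟨τ a #S, fun _ => ⟨hmin, fun r' h => h a ha⟩⟩
      · exact ⟨0, fun h => absurd h hS⟩
    choose g hg using hg
    obtain ⟨S, hS, hmax⟩ := Finset.exists_max_image (univ.filter fun S : Finset (Fin n) => j ∈ S) g
      ⟨{j}, by simp⟩
    simp only [mem_filter, mem_univ, true_and] at hS hmax
    exact ⟨g S, ⟨S, hS, (hg S hS).1⟩, fun S' hS' r' h => ((hg S' hS').2 r' h).trans (hmax S' hS')⟩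
  choose t ht1 ht2 using HT
  have ht0 : ∀ j, 0 ≤ t j := fun j => ht2 j {j} (by simp) 0 (by
    intro k hk; exact (hτ k _ (by simp)).1)
  set Z : Fin n → ℝ := fun k => GG t (t k) with hZ
  have hZ0 : ∀ k, 0 ≤ Z k := fun k => GG_nonneg t (ht0 k)
  have htZ : ∀ k, total Z k = t k := fun k => total_GG t ht0 k
  have hord : ∀ j k, t j ≤ t k ↔ Z j ≤ Z k := by
    intro j k; rw [← htZ, ← htZ, total_le_iff]
  -- for every `j`, and every set containing all agents with t ≥ t j
  have hlow : ∀ j (S : Finset (Fin n)), (∀ k, t j ≤ t k → k ∈ S) → t j ≤ τ j #S := by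
    intro j S hS
    obtain ⟨S0, hj, h0⟩ := ht1 j
    have hsub : S0 ⊆ S := fun k hk => hS k (ht2 k S0 hk _ h0)
    exact (h0 j hj).trans (hτmono j _ _ (card_pos.2 ⟨j, hj⟩) (card_le_card hsub))
  refine ⟨Z, ⟨hZ0, ?_⟩, ?_⟩
  · intro j y hy
    unfold U
    rw [htZ, Function.update_self]
    rcases le_total y (Z j) with hyZ | hyZ
    · rw [total_upd_le _ _ _ hyZ]
      set S : Finset (Fin n) := univ.filter fun k => t j ≤ t k with hS
      have hSpos : 0 < #S := card_pos.2 ⟨j, by simp [hS]⟩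
      have hSposR : (0:ℝ) < #S := by exact_mod_cast hSpos
      have h1 : t j ≤ τ j #S := hlow j S (by simp [hS])
      have hP := PP_mono (hbconc j) le_rfl h1 (hτ j _ hSpos).2.2.1
      have hle : ∑ k, min y (Z k) ≤ t j - #S * (Z j - y) := by
        rw [← htZ j, total_eq, le_sub_iff_add_le]
        have : (#S : ℝ) * (Z j - y) = ∑ k, if t j ≤ t k then (Z j - y) else 0 := by
          rw [← Finset.sum_filter, Finset.sum_const, nsmul_eq_mul]
        rw [this, ← Finset.sum_add_distrib]
        refine Finset.sum_le_sum fun k _ => ?_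
        split_ifs with hk
        · rw [hord] at hk
          rw [min_eq_left hk]
          linarith [min_le_left y (Z k)]
        · rw [add_zero]; exact min_le_min_right _ hyZ
      have h0 : 0 ≤ ∑ k, min y (Z k) := Finset.sum_nonneg fun k _ => le_min hy (hZ0 k)
      have h2 := hbm j (Set.mem_Ici.2 h0) (Set.mem_Ici.2 (h0.trans hle)) hle
      have h3 := hP (t j - #S * (Z j - y)) (h0.trans hle) (by
        nlinarith [mul_nonneg hSposR.le (sub_nonneg.2 hyZ)])
      have : c j / #S * (t j - #S * (Z j - y)) = c j / #S * t j - c j * (Z j - y) := by field_simp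
      rw [this] at h3
      linarith
    · rw [total_upd]
      set R : Finset (Fin n) := univ.filter fun k => t j < t k with hR
      have hjR : j ∉ R := by simp [hR]
      set S : Finset (Fin n) := insert j R with hS
      have hSpos : 0 < #S := card_pos.2 ⟨j, by simp [hS]⟩
      have hSposR : (0:ℝ) < #S := by exact_mod_cast hSpos
      have hcard : (#S : ℝ) = 1 + #R := by
        rw [hS, card_insert_of_notMem hjR]; push_cast; ring
      have h1 : τ j #S ≤ t j := by
        by_contra hcon
        push Not at hcon
        have hall : ∀ k ∈ S, t j < τ k #S := by
          intro k hk
          rw [hS, mem_insert] at hk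
          rcases hk with rfl | hk
          · exact hcon
          · have hk' : t j < t k := by simpa [hR] using hk
            refine hk'.trans_le (hlow k S ?_)
            intro l hl
            rw [hS, mem_insert]
            right
            simp only [hR, mem_filter, mem_univ, true_and]
            linarith
        obtain ⟨a, ha, hmin⟩ := Finset.exists_min_image S (fun k => τ k #S) ⟨j, by simp [hS]⟩
        have := ht2 j S (by simp [hS]) (τ a #S) hmin
        linarith [hall a ha]
      have hle : y + ∑ k ∈ univ.erase j, min y (Z k) ≤ t j + #S * (y - Z j) := by
        have e : t j = Z j + ∑ k ∈ univ.erase j, min (Z j) (Z k) := by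
          rw [← htZ j, total, Finset.filter_ne']
        have : (#R : ℝ) * (y - Z j) = ∑ k ∈ univ.erase j, if t j < t k then (y - Z j) else 0 := by
          rw [Finset.sum_erase _ (by simp), ← Finset.sum_filter, Finset.sum_const, nsmul_eq_mul]
        have h5 : ∑ k ∈ univ.erase j, min y (Z k) ≤
            ∑ k ∈ univ.erase j, (min (Z j) (Z k) + if t j < t k then (y - Z j) else 0) := by
          refine Finset.sum_le_sum fun k _ => ?_
          split_ifs with hk
          · have := (hord j k).1 hk.le
            rw [min_eq_left this]
            linarith [min_le_left y (Z k)]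
          · push Not at hk
            rw [hord] at hk
            rw [min_eq_right hk, add_zero]; exact min_le_right _ _
        rw [Finset.sum_add_distrib, ← this] at h5
        rw [hcard, e]
        linarith
      have h0 : 0 ≤ y + ∑ k ∈ univ.erase j, min y (Z k) :=
        add_nonneg hy (Finset.sum_nonneg fun k _ => le_min hy (hZ0 k))
      have h2 := hbm j (Set.mem_Ici.2 h0) (Set.mem_Ici.2 (h0.trans hle)) hle
      have h3 := (hτ j _ hSpos).2.2.2 (t j) (t j + #S * (y - Z j)) h1 (by
        nlinarith [mul_nonneg hSposR.le (sub_nonneg.2 hyZ)])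
      have : c j / #S * (t j + #S * (y - Z j)) = c j / #S * t j + c j * (y - Z j) := by field_simp
      rw [this] at h3
      linarith
  · intro S j r hj hr h
    rw [htZ]
    exact ht2 j S hj r fun k hk => (hτ k _ (card_pos.2 ⟨j, hj⟩)).2.1 r hr (h k hk)

/-- Truthfulness of the maximal-equilibrium mechanism under full enforcement: if `X` is the
maximal equilibrium of the true game and `X'` is the maximal equilibrium of the game in
which agent `i` misreports its type `(b̂ᵢ, ĉᵢ)`, then agent `i`'s true utility at `X'` is at
most its true utility at `X`. -/
theorem truthful_full_enforcement (n : ℕ) (hn : 1 ≤ n)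
    (b : Fin n → ℝ → ℝ) (c : Fin n → ℝ)
    (hc : ∀ j, 0 < c j)
    (hbc : ∀ j, ContinuousOn (b j) (Set.Ici 0))
    (hbm : ∀ j, MonotoneOn (b j) (Set.Ici 0))
    (hbconc : ∀ j, ConcaveOn ℝ (Set.Ici 0) (b j))
    (hvanish : ∀ j, Filter.Tendsto (fun t : ℝ => b j (t + 1) - b j t)
      Filter.atTop (nhds 0))
    (i : Fin n) (bhat : ℝ → ℝ) (chat : ℝ)
    (hchat : 0 < chat)
    (hbhatc : ContinuousOn bhat (Set.Ici 0))
    (hbhatm : MonotoneOn bhat (Set.Ici 0))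
    (hbhatconc : ConcaveOn ℝ (Set.Ici 0) bhat)
    (hbhatvanish : Filter.Tendsto (fun t : ℝ => bhat (t + 1) - bhat t)
      Filter.atTop (nhds 0))
    (X : Fin n → ℝ) (hX : IsNE b c X)
    (hXmax : ∀ X'' : Fin n → ℝ, IsNE b c X'' → ∀ j, total X'' j ≤ total X j)
    (X' : Fin n → ℝ)
    (hX' : IsNE (Function.update b i bhat) (Function.update c i chat) X')
    (hX'max : ∀ X'' : Fin n → ℝ,
      IsNE (Function.update b i bhat) (Function.update c i chat) X'' →
      ∀ j, total X'' j ≤ total X' j) :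
    b i (total X' i) - c i * X' i ≤ b i (total X i) - c i * X i := by
  obtain ⟨Z, hZ, hZmax⟩ := exists_max hc hbc hbm hbconc hvanish
  have hmax : ∀ (S : Finset (Fin n)) (j) (r : ℝ), j ∈ S → 0 ≤ r →
      (∀ k ∈ S, PP (b k) (c k / #S) r) → r ≤ total X j := fun S j r hj hr h =>
    (hZmax S j r hj hr h).trans (hXmax Z hZ j)
  have ht0 := total_nonneg hX.1
  have ht0' := total_nonneg hX'.1
  have hXr := rep hX.1 i
  have hXr' := rep hX'.1 i
  set t := total X with ht
  set t' := total X' with ht'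
  have hdiv : ∀ k (m m' : ℕ), 0 < m → m ≤ m' → c k / (m':ℝ) ≤ c k / m := by
    intro k m m' hm hmm
    have : (m:ℝ) ≤ m' := by exact_mod_cast hmm
    have h0 : (0:ℝ) < m := by exact_mod_cast hm
    exact div_le_div_of_nonneg_left (hc k).le h0 this
  have hP : ∀ k (S : Finset (Fin n)) r, (∀ l, t k ≤ t l → l ∈ S) → r ≤ t k →
      PP (b k) (c k / #S) r := by
    intro k S r hS hr
    refine PP_mono (hbconc k) (hdiv k _ _ (NN_pos t k) (card_le_card ?_)) hr (nec hX k (hbconc k))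
    intro l hl
    exact hS l (by simpa using hl)
  have hP' : ∀ k, k ≠ i → ∀ (S : Finset (Fin n)) r, (∀ l, t' k ≤ t' l → l ∈ S) → r ≤ t' k →
      PP (b k) (c k / #S) r := by
    intro k hk S r hS hr
    have hn := nec hX' k (by rw [Function.update_of_ne hk]; exact hbconc k)
    rw [Function.update_of_ne hk, Function.update_of_ne hk] at hn
    refine PP_mono (hbconc k) (hdiv k _ _ (NN_pos t' k) (card_le_card ?_)) hr hn
    intro l hl
    exact hS l (by simpa using hl)
  -- comparison of counts
  have hN : ∀ T, 0 ≤ T → T ≤ t i → NN t' T ≤ NN t T := by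
    intro T hT0 hT
    refine card_le_card ?_
    intro k hk
    simp only [mem_filter, mem_univ, true_and] at hk ⊢
    refine hmax (univ.filter fun l => T ≤ t l ∨ T ≤ t' l) k T (by simp [hk]) hT0 ?_
    intro l hl
    simp only [mem_filter, mem_univ, true_and] at hl
    by_cases hl' : T ≤ t l
    · refine hP l _ T (fun a ha => ?_) hl'
      simp only [mem_filter, mem_univ, true_and]
      left; linarith
    · have hli : l ≠ i := by rintro rfl; exact hl' hT
      have hl2 := hl.resolve_left hl'
      refine hP' l hli _ T (fun a ha => ?_) hl2
      simp only [mem_filter, mem_univ, true_and]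
      right; linarith
  have hG : ∀ T, 0 ≤ T → T ≤ t i → T ≤ t' i → GG t T ≤ GG t' T := by
    intro T hT0 hT hT'
    refine intervalIntegral.integral_mono_on hT0 (NN_int t 0 T) (NN_int t' 0 T) ?_
    intro s hs
    have h1 : 0 < NN t' s := card_pos.2 ⟨i, by simp; linarith [hs.2]⟩
    have h2 : (NN t' s : ℝ) ≤ NN t s := by exact_mod_cast hN s hs.1 (hs.2.trans hT)
    exact inv_anti₀ (by exact_mod_cast h1) h2
  rcases le_total (t' i) (t i) with hle | hle
  · have h1 := hG (t' i) (ht0' i) hle le_rfl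
    have hy : GG t (t' i) ≤ X i := by rw [hXr]; exact GG_mono t hle
    have hdev := hX.2 i (GG t (t' i)) (GG_nonneg t (ht0' i))
    unfold U at hdev
    have htot : total (Function.update X i (GG t (t' i))) i = t' i := by
      rw [total_upd_le _ _ _ hy, ← GG_sum t ht0 (ht0' i) i hle]
      refine Finset.sum_congr rfl fun k _ => ?_
      rw [GG_sum t ht0 (ht0' i) i hle, ← rep hX.1 k]
    rw [htot, Function.update_self, ← ht] at hdev
    rw [← hXr'] at h1
    nlinarith [mul_le_mul_of_nonneg_left h1 (hc i).le]
  · rcases eq_or_lt_of_le hle with heq | hlt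
    · have h1 := hG (t i) (ht0 i) le_rfl hle
      rw [← hXr, heq, ← hXr'] at h1
      rw [heq]
      nlinarith [mul_le_mul_of_nonneg_left h1 (hc i).le]
    have h1 := hG (t i) (ht0 i) le_rfl hle
    rw [← hXr] at h1
    set S : Finset (Fin n) := univ.filter fun k => t i < t' k with hS
    have hiS : i ∈ S := by simp [hS, hlt]
    have hSpos : (0:ℝ) < #S := by exact_mod_cast card_pos.2 ⟨i, hiS⟩
    obtain ⟨τ, hτ0, -, hτP, hτanti⟩ := tau_exists (hbconc i) (hbc i) (hvanish i) (c i / #S)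
      (div_pos (hc i) hSpos)
    have hτ : τ ≤ t i := by
      by_contra hcon
      push Not at hcon
      obtain ⟨a, ha, hmin⟩ := Finset.exists_min_image S t' ⟨i, hiS⟩
      have ha' : t i < t' a := by simpa [hS] using ha
      have hr : t i < min τ (t' a) := lt_min hcon ha'
      have := hmax S i (min τ (t' a)) hiS (le_min hτ0 (ht0' a)) (by
        intro k hk
        by_cases hki : k = i
        · subst hki
          exact PP_mono (hbconc k) le_rfl (min_le_left _ _) hτP
        · refine hP' k hki S _ (fun l hl => ?_) ((min_le_right _ _).trans (hmin k hk))
          simp only [hS, mem_filter, mem_univ, true_and] at hk ⊢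
          linarith)
      linarith
    have h2 := hτanti (t i) (t' i) hτ hle
    have h3 : GG t' (t i) + (t' i - t i) / #S ≤ X' i := by
      rw [hXr']
      have e := intervalIntegral.integral_add_adjacent_intervals (NN_int t' 0 (t i))
        (NN_int t' (t i) (t' i))
      have e2 : (∫ s in (t i)..(t' i), ((#S : ℝ))⁻¹) ≤ ∫ s in (t i)..(t' i), ((NN t' s : ℝ))⁻¹ := by
        refine intervalIntegral.integral_mono_on_of_le_Ioo hle intervalIntegrable_const
          (NN_int t' _ _) ?_
        intro s hs
        have hp : 0 < NN t' s := card_pos.2 ⟨i, by simp; linarith [hs.2]⟩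
        have hq : NN t' s ≤ #S := by
          refine card_le_card fun k hk => ?_
          simp only [hS, mem_filter, mem_univ, true_and] at hk ⊢
          linarith [hs.1]
        exact inv_anti₀ (by exact_mod_cast hp) (by exact_mod_cast hq)
      rw [intervalIntegral.integral_const, smul_eq_mul, ← div_eq_mul_inv] at e2
      unfold GG
      linarith
    have h4 : c i * (X i + (t' i - t i) / #S) ≤ c i * X' i :=
      mul_le_mul_of_nonneg_left (by linarith) (hc i).le
    have h5 : c i * (X i + (t' i - t i) / #S) = c i * X i + (c i / #S * t' i - c i / #S * t i) := by
      field_simp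
    linarith
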